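/- arXiv:2410.23146 — 3 statements merged into one kernel-verified Lean document; each statement's English description precedes it below -/
import Mathlib

section
/- Suppose we observe K distinct pairs of marginals (μ^(k),ν^(k)) ∈ Δ_N × Δ_M and values α^(k) ∈ ℝ, k = 1,…,K. Call c' ∈ ℝ^{N×M} consistent if OT_{c'}(μ^(k),ν^(k)) = α^(k) for all k, and assume at least one consistent matrix exists. Then there is exactly one consistent matrix if and only if there exists c₀ ∈ ℝ^{N×M} such that for every choice of extreme points u^(k) ∈ EP(μ^(k),ν^(k)), k = 1,…,K, the solution set of the system { ⟨c', u^(k)⟩ = α^(k) for all k, and ⟨c', v⟩ ≥ α^(k) for all v ∈ EP(μ^(k),ν^(k)) \ {u^(k)} and all k } is either empty or equal to {c₀}. -/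
open Finset

noncomputable section

/-- Frobenius inner product of two `N × M` real matrices. -/
def frob {N M : ℕ} (c π : Matrix (Fin N) (Fin M) ℝ) : ℝ := ∑ i, ∑ j, c i j * π i j

/-- The set `Π(μ,ν)` of transport plans between `μ` and `ν`. -/
def Plans {N M : ℕ} (μ : Fin N → ℝ) (ν : Fin M → ℝ) : Set (Matrix (Fin N) (Fin M) ℝ) :=
  {π | (∀ i j, 0 ≤ π i j) ∧ (∀ i, ∑ j, π i j = μ i) ∧ (∀ j, ∑ i, π i j = ν j)}

/-- The optimal transport cost `OT_c(μ,ν)`. -/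
def OTcost {N M : ℕ} (c : Matrix (Fin N) (Fin M) ℝ) (μ : Fin N → ℝ) (ν : Fin M → ℝ) : ℝ :=
  sInf (frob c '' Plans μ ν)

/-- The set `EP(μ,ν)` of extreme points of the transport polytope. -/
def EP {N M : ℕ} (μ : Fin N → ℝ) (ν : Fin M → ℝ) : Set (Matrix (Fin N) (Fin M) ℝ) :=
  Set.extremePoints ℝ (Plans μ ν)

lemma continuous_frob {N M : ℕ} (c : Matrix (Fin N) (Fin M) ℝ) : Continuous (frob c) := by
  unfold frob
  fun_prop

lemma frob_add_smul {N M : ℕ} (c x y : Matrix (Fin N) (Fin M) ℝ) (a b : ℝ) :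
    frob c (a • x + b • y) = a * frob c x + b * frob c y := by
  simp only [frob, Finset.mul_sum, ← Finset.sum_add_distrib, Matrix.add_apply, Matrix.smul_apply,
    smul_eq_mul]
  exact Finset.sum_congr rfl fun i _ => Finset.sum_congr rfl fun j _ => by ring

lemma plans_nonempty {N M : ℕ} {μ : Fin N → ℝ} {ν : Fin M → ℝ}
    (hμ : μ ∈ stdSimplex ℝ (Fin N)) (hν : ν ∈ stdSimplex ℝ (Fin M)) : (Plans μ ν).Nonempty := by
  refine ⟨Matrix.of fun i j => μ i * ν j, fun i j => mul_nonneg (hμ.1 i) (hν.1 j), fun i => ?_,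
    fun j => ?_⟩
  · simp [← Finset.mul_sum, hν.2]
  · simp [← Finset.sum_mul, hμ.2]

lemma isCompact_plans {N M : ℕ} (μ : Fin N → ℝ) (ν : Fin M → ℝ) : IsCompact (Plans μ ν) := by
  have hbox : IsCompact (Set.univ.pi fun i : Fin N => Set.univ.pi fun _ : Fin M =>
      Set.Icc 0 (μ i)) :=
    isCompact_univ_pi fun i => isCompact_univ_pi fun _ => isCompact_Icc
  refine hbox.of_isClosed_subset ?_ ?_
  · have h : Plans μ ν = (⋂ i, ⋂ j, {π : Matrix (Fin N) (Fin M) ℝ | 0 ≤ π i j}) ∩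
        ((⋂ i, {π : Matrix (Fin N) (Fin M) ℝ | ∑ j, π i j = μ i}) ∩
          ⋂ j, {π : Matrix (Fin N) (Fin M) ℝ | ∑ i, π i j = ν j}) := by
      ext π
      simp [Plans]
    rw [h]
    refine (isClosed_iInter fun i => isClosed_iInter fun j => ?_).inter
      ((isClosed_iInter fun i => ?_).inter (isClosed_iInter fun j => ?_))
    · exact isClosed_le (by fun_prop) (by fun_prop)
    · exact isClosed_eq (by fun_prop) (by fun_prop)
    · exact isClosed_eq (by fun_prop) (by fun_prop)
  · rintro π ⟨h0, h1, -⟩ i - j -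
    refine ⟨h0 i j, ?_⟩
    rw [← h1 i]
    exact Finset.single_le_sum (f := fun j => π i j) (fun j _ => h0 i j) (Finset.mem_univ j)

/-- A linear cost attains its minimum over the transport polytope at an extreme point. -/
lemma exists_mem_EP_isMinOn {N M : ℕ} (c : Matrix (Fin N) (Fin M) ℝ)
    {μ : Fin N → ℝ} {ν : Fin M → ℝ} (hne : (Plans μ ν).Nonempty) :
    ∃ u ∈ EP μ ν, IsMinOn (frob c) (Plans μ ν) u := by
  obtain ⟨p, hp, hpmin⟩ := (isCompact_plans μ ν).exists_isMinOn hne (continuous_frob c).continuousOn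
  let F : Set (Fin N → Fin M → ℝ) := Plans μ ν ∩ {x | frob c x = frob c p}
  have hF : IsCompact F :=
    (isCompact_plans μ ν).inter_right (isClosed_eq (continuous_frob c) continuous_const)
  obtain ⟨u, hu⟩ := hF.extremePoints_nonempty ⟨p, hp, rfl⟩
  have hext : IsExtreme ℝ (Plans μ ν : Set (Fin N → Fin M → ℝ)) F := by
    refine ⟨Set.inter_subset_left, ?_⟩
    rintro x hx y hy z ⟨-, hz⟩ ⟨a, b, ha, hb, hab, rfl⟩
    have hx' : frob c p ≤ frob c x := hpmin hx
    have hy' : frob c p ≤ frob c y := hpmin hy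
    have hz' : a * frob c x + b * frob c y = frob c p := (frob_add_smul c x y a b).symm.trans hz
    refine ⟨hx, le_antisymm ?_ hx'⟩
    obtain rfl : b = 1 - a := by linarith
    have := mul_le_mul_of_nonneg_left hy' hb.le
    exact le_of_mul_le_mul_left (by linarith) ha
  refine ⟨u, hext.extremePoints_subset_extremePoints hu, fun v hv => ?_⟩
  have huF : frob c u = frob c p := hu.1.2
  exact huF.le.trans (hpmin hv)

lemma OTcost_eq_of_isMinOn {N M : ℕ} {c u : Matrix (Fin N) (Fin M) ℝ}
    {μ : Fin N → ℝ} {ν : Fin M → ℝ} (hu : u ∈ Plans μ ν) (hmin : IsMinOn (frob c) (Plans μ ν) u) :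
    OTcost c μ ν = frob c u :=
  IsLeast.csInf_eq ⟨Set.mem_image_of_mem _ hu, by rintro _ ⟨v, hv, rfl⟩; exact hmin hv⟩

lemma OTcost_eq_of_forall_EP {N M : ℕ} {c u : Matrix (Fin N) (Fin M) ℝ}
    {μ : Fin N → ℝ} {ν : Fin M → ℝ} (hu : u ∈ EP μ ν) (h : ∀ v ∈ EP μ ν, frob c u ≤ frob c v) :
    OTcost c μ ν = frob c u := by
  obtain ⟨w, hw, hwmin⟩ := exists_mem_EP_isMinOn c ⟨u, hu.1⟩
  exact OTcost_eq_of_isMinOn hu.1 fun v hv => (h w hw).trans (hwmin hv)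

/-- Identifiability from total costs alone: assuming a consistent cost matrix exists, it is
unique if and only if, for every choice of extreme points, the corresponding linear system is
either inconsistent or has a unique solution independent of the choice. -/
theorem stmt3 (N M K : ℕ) (hN : 1 ≤ N) (hM : 1 ≤ M)
    (μ : Fin K → Fin N → ℝ) (ν : Fin K → Fin M → ℝ)
    (hμ : ∀ k, μ k ∈ stdSimplex ℝ (Fin N)) (hν : ∀ k, ν k ∈ stdSimplex ℝ (Fin M))
    (hdist : Function.Injective (fun k => (μ k, ν k)))
    (α : Fin K → ℝ)
    (hex : ∃ c : Matrix (Fin N) (Fin M) ℝ, ∀ k, OTcost c (μ k) (ν k) = α k) :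
    (∃! c' : Matrix (Fin N) (Fin M) ℝ, ∀ k, OTcost c' (μ k) (ν k) = α k) ↔
      ∃ c₀ : Matrix (Fin N) (Fin M) ℝ,
        ∀ u : (k : Fin K) → Matrix (Fin N) (Fin M) ℝ, (∀ k, u k ∈ EP (μ k) (ν k)) →
          ({c' : Matrix (Fin N) (Fin M) ℝ |
              (∀ k, frob c' (u k) = α k) ∧
              ∀ k, ∀ v ∈ EP (μ k) (ν k) \ {u k}, α k ≤ frob c' v} = ∅ ∨
           {c' : Matrix (Fin N) (Fin M) ℝ |
              (∀ k, frob c' (u k) = α k) ∧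
              ∀ k, ∀ v ∈ EP (μ k) (ν k) \ {u k}, α k ≤ frob c' v} = {c₀}) := by
  have hcons : ∀ u : (k : Fin K) → Matrix (Fin N) (Fin M) ℝ, (∀ k, u k ∈ EP (μ k) (ν k)) →
      ∀ c, (∀ k, frob c (u k) = α k) →
        (∀ k, ∀ v ∈ EP (μ k) (ν k) \ {u k}, α k ≤ frob c v) →
        ∀ k, OTcost c (μ k) (ν k) = α k := by
    intro u hu c heq hle k
    rw [← heq k]
    refine OTcost_eq_of_forall_EP (hu k) fun v hv => ?_
    by_cases hvu : v = u k
    · rw [hvu]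
    · exact (heq k).le.trans (hle k v ⟨hv, hvu⟩)
  constructor
  · rintro ⟨c₀, -, huniq⟩
    refine ⟨c₀, fun u hu => Set.subset_singleton_iff_eq.1 ?_⟩
    rintro c ⟨heq, hle⟩
    exact huniq c (hcons u hu c heq hle)
  · rintro ⟨c₀, hc₀⟩
    have key : ∀ c, (∀ k, OTcost c (μ k) (ν k) = α k) → c = c₀ := by
      intro c hc
      choose u hu hmin using fun k => exists_mem_EP_isMinOn c (plans_nonempty (hμ k) (hν k))
      have hval : ∀ k, frob c (u k) = α k := fun k =>
        (OTcost_eq_of_isMinOn (hu k).1 (hmin k)).symm.trans (hc k)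
      have hmem : c ∈ {c' : Matrix (Fin N) (Fin M) ℝ | (∀ k, frob c' (u k) = α k) ∧
          ∀ k, ∀ v ∈ EP (μ k) (ν k) \ {u k}, α k ≤ frob c' v} :=
        ⟨hval, fun k v hv => (hval k).ge.trans (hmin k hv.1.1)⟩
      rcases hc₀ u hu with h | h
      · rw [h] at hmem
        exact hmem.elim
      · rw [h] at hmem
        exact hmem
    obtain ⟨c, hc⟩ := hex
    exact ⟨c, hc, fun c' hc' => (key c' hc').trans (key c hc).symm⟩
end
end

section
/- Let c ∈ ℝ^{N×M} and suppose that for k = 1,…,K we have distinct pairs of marginals (μ^(k),ν^(k)) ∈ Δ_N × Δ_M, optimal plans π^(k) ∈ OPT_c(μ^(k),ν^(k)), and extreme points u^(1,k),…,u^(L_k,k) ∈ EP(μ^(k),ν^(k)) representing π^(k). Suppose that dim span{π^(k) − u^(ℓ,k) : ℓ ∈ {1,…,L_k}, k ∈ {1,…,K}} = (N−1)(M−1) − S for some S ∈ ℕ₀. Then there exist S linearly independent matrices w_1,…,w_S ∈ ℝ^{N×M} such that every c' ∈ ℝ^{N×M} with π^(k) ∈ OPT_{c'}(μ^(k),ν^(k))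 for all k satisfies c' − c ∈ {a ⊕ b : a ∈ ℝ^N, b ∈ ℝ^M} + span{w_1,…,w_S}. -/
open Finset

noncomputable section

/-- The set `OPT_c(μ,ν)` of optimal transport plans. -/
def OPT {N M : ℕ} (c : Matrix (Fin N) (Fin M) ℝ) (μ : Fin N → ℝ) (ν : Fin M → ℝ) :
    Set (Matrix (Fin N) (Fin M) ℝ) :=
  {π ∈ Plans μ ν | frob c π = OTcost c μ ν}

/-- The outer sum `f ⊕ g = [f_i + g_j]_{i,j}`. -/
def oplus {N M : ℕ} (f : Fin N → ℝ) (g : Fin M → ℝ) : Matrix (Fin N) (Fin M) ℝ :=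
  fun i j => f i + g j

/-- The Frobenius inner product as a bilinear form. -/
def frobForm (N M : ℕ) : LinearMap.BilinForm ℝ (Matrix (Fin N) (Fin M) ℝ) :=
  LinearMap.mk₂ ℝ frob
    (fun a b c => by simp [frob, add_mul, Finset.sum_add_distrib])
    (fun r a b => by simp [frob, mul_assoc, Finset.mul_sum])
    (fun a b c => by simp [frob, mul_add, Finset.sum_add_distrib])
    (fun r a b => by simp [frob, mul_left_comm, Finset.mul_sum])

theorem frobForm_apply {N M : ℕ} (a b : Matrix (Fin N) (Fin M) ℝ) :
    frobForm N M a b = frob a b := rfl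

theorem frob_comm {N M : ℕ} (a b : Matrix (Fin N) (Fin M) ℝ) : frob a b = frob b a := by
  simp [frob, mul_comm]

theorem frobForm_isRefl (N M : ℕ) : (frobForm N M).IsRefl := fun a b h => by
  rwa [frobForm_apply, frob_comm]

theorem frobForm_nondegenerate (N M : ℕ) : (frobForm N M).Nondegenerate := by
  refine (frobForm_isRefl N M).nondegenerate_iff_separatingLeft.2 fun a h => ?_
  have haa : ∑ i, ∑ j, a i j * a i j = 0 := h a
  ext i j
  have hi := (Finset.sum_eq_zero_iff_of_nonneg fun i _ =>
    Finset.sum_nonneg fun j _ => mul_self_nonneg (a i j)).1 haa i (Finset.mem_univ i)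
  exact mul_self_eq_zero.1 ((Finset.sum_eq_zero_iff_of_nonneg fun j _ =>
    mul_self_nonneg (a i j)).1 hi j (Finset.mem_univ j))

/-- The outer sum as a linear map. -/
def oplusMap (N M : ℕ) : ((Fin N → ℝ) × (Fin M → ℝ)) →ₗ[ℝ] Matrix (Fin N) (Fin M) ℝ where
  toFun p := oplus p.1 p.2
  map_add' p q := by
    ext i j
    simp only [oplus, Prod.fst_add, Prod.snd_add, Pi.add_apply, Matrix.add_apply]
    ring
  map_smul' r p := by
    ext i j
    simp [oplus, mul_add]

theorem span_oplus (N M : ℕ) :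
    Submodule.span ℝ {x : Matrix (Fin N) (Fin M) ℝ | ∃ a b, x = oplus a b} =
      LinearMap.range (oplusMap N M) := by
  rw [← Submodule.span_eq (LinearMap.range (oplusMap N M))]
  congr 1
  ext x
  simp [oplusMap, eq_comm]

theorem finrank_range_oplusMap {N M : ℕ} (hN : 1 ≤ N) (hM : 1 ≤ M) :
    Module.finrank ℝ (LinearMap.range (oplusMap N M)) + 1 = N + M := by
  have hker : Module.finrank ℝ (LinearMap.ker (oplusMap N M)) = 1 := by
    let i₀ : Fin N := ⟨0, hN⟩
    let j₀ : Fin M := ⟨0, hM⟩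
    let v : LinearMap.ker (oplusMap N M) :=
      ⟨(fun _ => 1, fun _ => -1), by ext i j; simp [oplusMap, oplus]⟩
    have hv : v ≠ 0 := fun h => by
      have := congrFun (congrArg (fun x => x.1.1) h) i₀
      simp [v] at this
    refine (finrank_eq_one_iff_of_nonzero' v hv).2 fun p => ?_
    have hp : ∀ i j, p.1.1 i + p.1.2 j = 0 := fun i j => congrFun (congrFun p.2 i) j
    refine ⟨p.1.1 i₀, Subtype.ext (Prod.ext (funext fun i => ?_) (funext fun j => ?_))⟩
    · have h₁ := hp i j₀
      have h₂ := hp i₀ j₀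
      simp only [v, Submodule.coe_smul, Prod.smul_fst, Pi.smul_apply, smul_eq_mul]
      linarith
    · have h := hp i₀ j
      simp only [v, Submodule.coe_smul, Prod.smul_snd, Pi.smul_apply, smul_eq_mul]
      linarith
  have h := LinearMap.finrank_range_add_finrank_ker (oplusMap N M)
  rw [hker] at h
  simpa using h

theorem frob_oplus {N M : ℕ} {μ : Fin N → ℝ} {ν : Fin M → ℝ} {p : Matrix (Fin N) (Fin M) ℝ}
    (hp : p ∈ Plans μ ν) (a : Fin N → ℝ) (b : Fin M → ℝ) :
    frob (oplus a b) p = ∑ i, a i * μ i + ∑ j, b j * ν j := by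
  simp only [frob, oplus, add_mul, Finset.sum_add_distrib]
  rw [Finset.sum_comm (f := fun i j => b j * p i j)]
  simp only [← Finset.mul_sum, hp.2.1, hp.2.2]

theorem bddBelow_frob_image_plans {N M : ℕ} (c : Matrix (Fin N) (Fin M) ℝ) (μ : Fin N → ℝ)
    (ν : Fin M → ℝ) : BddBelow (frob c '' Plans μ ν) := by
  refine ⟨∑ i, ∑ j, -(|c i j| * μ i), ?_⟩
  rintro _ ⟨p, hp, rfl⟩
  refine Finset.sum_le_sum fun i _ => Finset.sum_le_sum fun j _ => ?_
  have h₁ : p i j ≤ μ i := by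
    rw [← hp.2.1 i]
    exact Finset.single_le_sum (fun j _ => hp.1 i j) (Finset.mem_univ j)
  have h₂ := mul_le_mul_of_nonneg_left h₁ (abs_nonneg (c i j))
  have h₃ := mul_le_mul_of_nonneg_right (neg_abs_le (c i j)) (hp.1 i j)
  linarith

theorem frob_le_of_mem_OPT {N M : ℕ} {c : Matrix (Fin N) (Fin M) ℝ} {μ : Fin N → ℝ}
    {ν : Fin M → ℝ} {p q : Matrix (Fin N) (Fin M) ℝ} (hp : p ∈ OPT c μ ν) (hq : q ∈ Plans μ ν) :
    frob c p ≤ frob c q := by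
  rw [hp.2]
  exact csInf_le (bddBelow_frob_image_plans c μ ν) ⟨q, hq, rfl⟩

/-- Every plan occurring with positive weight in a convex representation of an optimal plan has
the same cost as the optimal plan. -/
theorem frob_sub_eq_zero_of_mem_OPT {N M : ℕ} {ι : Type*} [Fintype ι]
    {c : Matrix (Fin N) (Fin M) ℝ} {μ : Fin N → ℝ} {ν : Fin M → ℝ}
    {p : Matrix (Fin N) (Fin M) ℝ} (hp : p ∈ OPT c μ ν) {u : ι → Matrix (Fin N) (Fin M) ℝ}
    (hu : ∀ l, u l ∈ Plans μ ν) {lam : ι → ℝ} (hpos : ∀ l, 0 < lam l) (hsum : ∑ l, lam l = 1)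
    (hrep : p = ∑ l, lam l • u l) (l : ι) : frob c (p - u l) = 0 := by
  have hle : ∀ l, 0 ≤ lam l * (frob c (u l) - frob c p) := fun l =>
    mul_nonneg (hpos l).le (sub_nonneg.2 (frob_le_of_mem_OPT hp (hu l)))
  have hcost : frob c p = ∑ l, lam l * frob c (u l) := by
    rw [← frobForm_apply]
    conv_lhs => rw [hrep]
    simp [frobForm_apply]
  have hzero : ∑ l, lam l * (frob c (u l) - frob c p) = 0 := by
    simp only [mul_sub, Finset.sum_sub_distrib, ← Finset.sum_mul, hsum, ← hcost]
    ring
  have hl := (Finset.sum_eq_zero_iff_of_nonneg fun l _ => hle l).1 hzero l (Finset.mem_univ l)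
  have heq := (mul_eq_zero.1 hl).resolve_left (hpos l).ne'
  rw [← frobForm_apply, map_sub, frobForm_apply, frobForm_apply]
  linarith

/-- A subspace `O ≤ P` of codimension `S` is completed to `P` by `S` independent vectors. -/
theorem exists_linearIndependent_sup_span_eq {𝕜 E : Type*} [Field 𝕜] [AddCommGroup E] [Module 𝕜 E]
    [FiniteDimensional 𝕜 E] {O P : Submodule 𝕜 E} (hOP : O ≤ P) {S : ℕ}
    (hS : Module.finrank 𝕜 O + S = Module.finrank 𝕜 P) :
    ∃ w : Fin S → E, LinearIndependent 𝕜 w ∧ O ⊔ Submodule.span 𝕜 (Set.range w) = P := by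
  obtain ⟨Q, hQ⟩ := Submodule.exists_isCompl O
  have hsup : O ⊔ Q ⊓ P = P := by
    rw [← sup_inf_assoc_of_le Q hOP, hQ.sup_eq_top, top_inf_eq]
  have hinf : O ⊓ (Q ⊓ P) = ⊥ := by rw [← inf_assoc, hQ.inf_eq_bot, bot_inf_eq]
  have hdim := Submodule.finrank_sup_add_finrank_inf_eq O (Q ⊓ P)
  rw [hsup, hinf, finrank_bot] at hdim
  generalize Q ⊓ P = R at hsup hdim
  have b := Module.finBasisOfFinrankEq 𝕜 R (n := S) (by omega)
  have hspan : Submodule.span 𝕜 (Set.range (R.subtype ∘ b)) = R := by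
    rw [Set.range_comp, ← Submodule.map_span, b.span_eq, Submodule.map_subtype_top]
  refine ⟨R.subtype ∘ b, b.linearIndependent.map' _ (Submodule.ker_subtype _), ?_⟩
  rw [hspan, hsup]

/-- Identifiability from OT plans alone (direct part): if the differences `π^(k) − u^(ℓ,k)` span
a space of dimension `(N−1)(M−1) − S`, then the cost matrix is identifiable up to shift
equivalence and the span of `S` linearly independent matrices. -/
theorem stmt8 (N M K : ℕ) (hN : 1 ≤ N) (hM : 1 ≤ M)
    (μ : Fin K → Fin N → ℝ) (ν : Fin K → Fin M → ℝ)
    (hμ : ∀ k, μ k ∈ stdSimplex ℝ (Fin N)) (hν : ∀ k, ν k ∈ stdSimplex ℝ (Fin M))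
    (hdist : Function.Injective (fun k => (μ k, ν k)))
    (c : Matrix (Fin N) (Fin M) ℝ)
    (π : Fin K → Matrix (Fin N) (Fin M) ℝ) (hπ : ∀ k, π k ∈ OPT c (μ k) (ν k))
    (L : Fin K → ℕ) (u : (k : Fin K) → Fin (L k) → Matrix (Fin N) (Fin M) ℝ)
    (hu : ∀ k ℓ, u k ℓ ∈ EP (μ k) (ν k))
    (hrep : ∀ k, ∃ lam : Fin (L k) → ℝ,
      (∀ ℓ, 0 < lam ℓ) ∧ (∑ ℓ, lam ℓ = 1) ∧ π k = ∑ ℓ, lam ℓ • u k ℓ)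
    (S : ℕ)
    (hdim : Module.finrank ℝ
        (Submodule.span ℝ {d : Matrix (Fin N) (Fin M) ℝ | ∃ k ℓ, d = π k - u k ℓ}) + S =
      (N - 1) * (M - 1)) :
    ∃ w : Fin S → Matrix (Fin N) (Fin M) ℝ, LinearIndependent ℝ w ∧
      ∀ c' : Matrix (Fin N) (Fin M) ℝ, (∀ k, π k ∈ OPT c' (μ k) (ν k)) →
        c' - c ∈ Submodule.span ℝ {x : Matrix (Fin N) (Fin M) ℝ | ∃ a b, x = oplus a b} ⊔
          Submodule.span ℝ (Set.range w) := by
  set V := Submodule.span ℝ {d : Matrix (Fin N) (Fin M) ℝ | ∃ k ℓ, d = π k - u k ℓ} with hV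
  have hmem : ∀ x : Matrix (Fin N) (Fin M) ℝ, (∀ k ℓ, frob x (π k - u k ℓ) = 0) →
      x ∈ (frobForm N M).orthogonal V := by
    intro x hx d hd
    have hle : V ≤ LinearMap.ker (frobForm N M x) := by
      rw [hV, Submodule.span_le]
      rintro _ ⟨k, ℓ, rfl⟩
      exact hx k ℓ
    exact (frobForm_isRefl N M) _ _ (hle hd)
  have hOP : LinearMap.range (oplusMap N M) ≤ (frobForm N M).orthogonal V := by
    rintro _ ⟨⟨a, b⟩, rfl⟩
    refine hmem _ fun k ℓ => ?_
    change frob (oplus a b) _ = 0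
    rw [← frobForm_apply, map_sub, frobForm_apply, frobForm_apply, frob_oplus (hπ k).1,
      frob_oplus (hu k ℓ).1, sub_self]
  have hP := LinearMap.BilinForm.finrank_orthogonal (frobForm_nondegenerate N M) V
  have hO := finrank_range_oplusMap hN hM
  have hcard : Module.finrank ℝ (LinearMap.range (oplusMap N M)) + S =
      Module.finrank ℝ ((frobForm N M).orthogonal V) := by
    obtain ⟨n, rfl⟩ := Nat.exists_eq_add_of_le' hN
    obtain ⟨m, rfl⟩ := Nat.exists_eq_add_of_le' hM
    rw [Module.finrank_matrix] at hP
    simp only [Fintype.card_fin, Module.finrank_self, mul_one, Nat.add_sub_cancel] at hP hdim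
    have hmul : (n + 1) * (m + 1) = n * m + n + m + 1 := by ring
    omega
  obtain ⟨w, hw, hspan⟩ := exists_linearIndependent_sup_span_eq hOP hcard
  refine ⟨w, hw, fun c' hc' => ?_⟩
  rw [span_oplus, hspan]
  have hzero : ∀ x : Matrix (Fin N) (Fin M) ℝ, (∀ k, π k ∈ OPT x (μ k) (ν k)) →
      x ∈ (frobForm N M).orthogonal V := fun x hx => hmem x fun k ℓ => by
    obtain ⟨lam, hpos, hsum, hk⟩ := hrep k
    exact frob_sub_eq_zero_of_mem_OPT (hx k) (fun ℓ => (hu k ℓ).1) hpos hsum hk ℓ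
  exact Submodule.sub_mem _ (hzero c' hc') (hzero c hπ)
end
end

section
/- Suppose we observe K pairs of marginals (μ^(k),ν^(k)) ∈ Δ_N × Δ_M, values α^(k) ∈ ℝ, plans π^(k) ∈ Π(μ^(k),ν^(k)), and pairs (f^(k),g^(k)) ∈ ℝ^N × ℝ^M. Call c' ∈ ℝ^{N×M} consistent if for all k: (f^(k),g^(k)) ∈ Φ_{c'} and α^(k) = OT_{c'}(μ^(k),ν^(k)) = ⟨c',π^(k)⟩ = ⟨f^(k),μ^(k)⟩ + ⟨g^(k),ν^(k)⟩. Assume at least one consistent matrix c exists. Then: (i) any two consistent matrices agree at every index (i,j) ∈ ∪_{k=1}^K supp π^(k), where supp π = {(i,j) : π_{i,j} > 0}; and (ii) the consistent matrix is unique (c is identifiable in ℝ^{N×M}) if and only if ∪_{k=1}^K supp π^(k) = {1,…,N}×{1,…,M}. -/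
open Finset

noncomputable section

/-- A cost matrix `c'` is consistent with the full OT information (total costs, OT plans and
optimal potentials). -/
def Consistent {N M K : ℕ} (μ : Fin K → Fin N → ℝ) (ν : Fin K → Fin M → ℝ)
    (α : Fin K → ℝ) (π : Fin K → Matrix (Fin N) (Fin M) ℝ)
    (f : Fin K → Fin N → ℝ) (g : Fin K → Fin M → ℝ)
    (c' : Matrix (Fin N) (Fin M) ℝ) : Prop :=
  ∀ k, (∀ i j, f k i + g k j ≤ c' i j) ∧
    α k = OTcost c' (μ k) (ν k) ∧
    α k = frob c' (π k) ∧
    α k = (∑ i, f k i * μ k i) + (∑ j, g k j * ν k j)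

/-- The duality gap of a plan is the sum of the slacks of the dual constraints weighted by it. -/
lemma frob_sub_dual {N M : ℕ} {μ : Fin N → ℝ} {ν : Fin M → ℝ} {π : Matrix (Fin N) (Fin M) ℝ}
    (hπ : π ∈ Plans μ ν) (c : Matrix (Fin N) (Fin M) ℝ) (f : Fin N → ℝ) (g : Fin M → ℝ) :
    frob c π - ((∑ i, f i * μ i) + ∑ j, g j * ν j) =
      ∑ i, ∑ j, (c i j - (f i + g j)) * π i j := by
  obtain ⟨-, hrow, hcol⟩ := hπ
  have hf : ∑ i, f i * μ i = ∑ i, ∑ j, f i * π i j := by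
    simp only [← hrow, mul_sum]
  have hg : ∑ j, g j * ν j = ∑ i, ∑ j, g j * π i j := by
    rw [sum_comm]
    simp only [← hcol, mul_sum]
  simp only [frob, hf, hg, sub_mul, add_mul, sum_sub_distrib, sum_add_distrib]

/-- Weak duality. -/
lemma dual_le_frob {N M : ℕ} {μ : Fin N → ℝ} {ν : Fin M → ℝ} {c π : Matrix (Fin N) (Fin M) ℝ}
    (hπ : π ∈ Plans μ ν) {f : Fin N → ℝ} {g : Fin M → ℝ} (hfg : ∀ i j, f i + g j ≤ c i j) :
    (∑ i, f i * μ i) + ∑ j, g j * ν j ≤ frob c π := by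
  rw [← sub_nonneg, frob_sub_dual hπ]
  exact sum_nonneg fun i _ ↦ sum_nonneg fun j _ ↦
    mul_nonneg (sub_nonneg.2 (hfg i j)) (hπ.1 i j)

/-- Complementary slackness. -/
lemma eq_add_of_frob_eq_dual {N M : ℕ} {μ : Fin N → ℝ} {ν : Fin M → ℝ}
    {c π : Matrix (Fin N) (Fin M) ℝ} (hπ : π ∈ Plans μ ν) {f : Fin N → ℝ} {g : Fin M → ℝ}
    (hfg : ∀ i j, f i + g j ≤ c i j)
    (heq : frob c π = (∑ i, f i * μ i) + ∑ j, g j * ν j) {i : Fin N} {j : Fin M}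
    (hij : 0 < π i j) : c i j = f i + g j := by
  have hterm : ∀ i j, 0 ≤ (c i j - (f i + g j)) * π i j := fun i j ↦
    mul_nonneg (sub_nonneg.2 (hfg i j)) (hπ.1 i j)
  have hsum := frob_sub_dual hπ c f g
  rw [heq, sub_self, eq_comm,
    sum_eq_zero_iff_of_nonneg fun i _ ↦ sum_nonneg fun j _ ↦ hterm i j] at hsum
  have hzero := (sum_eq_zero_iff_of_nonneg fun j _ ↦ hterm i j).1 (hsum i (mem_univ i)) j
    (mem_univ j)
  exact sub_eq_zero.1 ((mul_eq_zero.1 hzero).resolve_right (ne_of_gt hij))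

/-- A plan whose cost equals the value of a dual feasible pair is optimal. -/
lemma OTcost_eq_of_frob_eq_dual {N M : ℕ} {μ : Fin N → ℝ} {ν : Fin M → ℝ}
    {c π : Matrix (Fin N) (Fin M) ℝ} (hπ : π ∈ Plans μ ν) {f : Fin N → ℝ} {g : Fin M → ℝ}
    (hfg : ∀ i j, f i + g j ≤ c i j)
    (heq : frob c π = (∑ i, f i * μ i) + ∑ j, g j * ν j) : OTcost c μ ν = frob c π := by
  refine IsLeast.csInf_eq ⟨Set.mem_image_of_mem _ hπ, ?_⟩
  rintro _ ⟨ρ, hρ, rfl⟩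
  exact heq ▸ dual_le_frob hρ hfg

/-- Raising a consistent cost off the supports of the observed plans keeps it consistent. -/
lemma Consistent.of_le {N M K : ℕ} {μ : Fin K → Fin N → ℝ} {ν : Fin K → Fin M → ℝ}
    {α : Fin K → ℝ} {π : Fin K → Matrix (Fin N) (Fin M) ℝ} (hπ : ∀ k, π k ∈ Plans (μ k) (ν k))
    {f : Fin K → Fin N → ℝ} {g : Fin K → Fin M → ℝ} {c c' : Matrix (Fin N) (Fin M) ℝ}
    (hc : Consistent μ ν α π f g c) (hle : ∀ i j, c i j ≤ c' i j)
    (heq : ∀ k i j, 0 < π k i j → c' i j = c i j) : Consistent μ ν α π f g c' := by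
  intro k
  obtain ⟨hfg, -, hplan, hdual⟩ := hc k
  have hfg' : ∀ i j, f k i + g k j ≤ c' i j := fun i j ↦ (hfg i j).trans (hle i j)
  have hfrob : frob c' (π k) = frob c (π k) := by
    refine sum_congr rfl fun i _ ↦ sum_congr rfl fun j _ ↦ ?_
    rcases ((hπ k).1 i j).eq_or_lt with h | h
    · rw [← h, mul_zero, mul_zero]
    · rw [heq k i j h]
  have hplan' : α k = frob c' (π k) := hplan.trans hfrob.symm
  exact ⟨hfg', hplan'.trans
    (OTcost_eq_of_frob_eq_dual (hπ k) hfg' (hplan'.symm.trans hdual)).symm, hplan', hdual⟩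

/-- Identifiability from full information: consistent cost matrices agree on the union of the
supports of the observed plans, and the consistent matrix is unique iff that union is full. -/
theorem stmt14 (N M K : ℕ) (hN : 1 ≤ N) (hM : 1 ≤ M)
    (μ : Fin K → Fin N → ℝ) (ν : Fin K → Fin M → ℝ)
    (hμ : ∀ k, μ k ∈ stdSimplex ℝ (Fin N)) (hν : ∀ k, ν k ∈ stdSimplex ℝ (Fin M))
    (α : Fin K → ℝ)
    (π : Fin K → Matrix (Fin N) (Fin M) ℝ) (hπ : ∀ k, π k ∈ Plans (μ k) (ν k))
    (f : Fin K → Fin N → ℝ) (g : Fin K → Fin M → ℝ)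
    (hex : ∃ c : Matrix (Fin N) (Fin M) ℝ, Consistent μ ν α π f g c) :
    (∀ c₁ c₂ : Matrix (Fin N) (Fin M) ℝ, Consistent μ ν α π f g c₁ →
      Consistent μ ν α π f g c₂ →
      ∀ i j, (∃ k, 0 < π k i j) → c₁ i j = c₂ i j) ∧
    ((∃! c' : Matrix (Fin N) (Fin M) ℝ, Consistent μ ν α π f g c') ↔
      ∀ i j, ∃ k, 0 < π k i j) := by
  have hagree : ∀ c₁ c₂ : Matrix (Fin N) (Fin M) ℝ, Consistent μ ν α π f g c₁ →
      Consistent μ ν α π f g c₂ → ∀ i j, (∃ k, 0 < π k i j) → c₁ i j = c₂ i j := by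
    rintro c₁ c₂ h₁ h₂ i j ⟨k, hk⟩
    have hslack : ∀ c, Consistent μ ν α π f g c → c i j = f k i + g k j := fun c hc ↦
      eq_add_of_frob_eq_dual (hπ k) (hc k).1 ((hc k).2.2.1.symm.trans (hc k).2.2.2) hk
    rw [hslack c₁ h₁, hslack c₂ h₂]
  refine ⟨hagree, ?_, fun hfull ↦ ?_⟩
  · rintro ⟨c, hc, huniq⟩ i j
    by_contra! hij
    let c' : Matrix (Fin N) (Fin M) ℝ := fun a b ↦ if a = i ∧ b = j then c a b + 1 else c a b
    have hc' : Consistent μ ν α π f g c' := by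
      refine hc.of_le hπ (fun a b ↦ ?_) fun k a b hab ↦ if_neg ?_
      · simp only [c']
        split_ifs <;> linarith
      · rintro ⟨rfl, rfl⟩
        exact (hij k).not_gt hab
    have := congrFun (congrFun (huniq c' hc') i) j
    simp [c'] at this
  · obtain ⟨c, hc⟩ := hex
    exact ⟨c, hc, fun c' hc' ↦ Matrix.ext fun i j ↦ hagree c' c hc' hc i j (hfull i j)⟩
end
end
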